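/- arXiv:2506.22269 — 2 statements merged into one kernel-verified Lean document; each statement's English description precedes it below -/
import Mathlib

section
/- Let G be a traceable cograph on n vertices. Then G contains at least (1/4)·n·log₂(n) edges. -/
/-- A graph is traceable if it contains a Hamiltonian path. -/
def Traceable {V : Type*} [DecidableEq V] (G : SimpleGraph V) : Prop :=
  ∃ (u v : V) (p : G.Walk u v), p.IsHamiltonian

/-- A graph is a cograph iff it contains no induced path on four vertices. -/
def IsCograph {V : Type*} (G : SimpleGraph V) : Prop :=
  ¬ ∃ a b c d : V, [a, b, c, d].Nodup ∧
      G.Adj a b ∧ G.Adj b c ∧ G.Adj c d ∧ ¬ G.Adj a c ∧ ¬ G.Adj a d ∧ ¬ G.Adj b d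

namespace SimpleGraph

theorem isCograph_compl {V : Type*} {G : SimpleGraph V} (hG : IsCograph G) : IsCograph Gᶜ := by
  rintro ⟨a, b, c, d, hn, hab, hbc, hcd, hac, had, hbd⟩
  refine hG ⟨b, d, a, c, ?_⟩
  simp only [List.nodup_cons, List.mem_cons, List.not_mem_nil, or_false, not_or,
    compl_adj, not_and, not_not] at *
  grind [G.adj_comm]

variable {V : Type*} [DecidableEq V]

/-- The subgraph induced on `S` is the disjoint union of two nonempty graphs. -/
def IsDisjointUnionOn (G : SimpleGraph V) (S : Finset V) : Prop :=
  ∃ A B : Finset V, A.Nonempty ∧ B.Nonempty ∧ Disjoint A B ∧ A ∪ B = S ∧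
    ∀ x ∈ A, ∀ y ∈ B, ¬ G.Adj x y

theorem IsDisjointUnionOn.insert_vertex {G : SimpleGraph V} (hG : IsCograph G) {S : Finset V} {v : V}
    (hv : v ∉ S) (h : G.IsDisjointUnionOn S) :
    G.IsDisjointUnionOn (insert v S) ∨ Gᶜ.IsDisjointUnionOn (insert v S) := by
  obtain ⟨A, B, hA, hB, hAB, rfl, hadj⟩ := h
  classical
  by_contra! hcon
  obtain ⟨hcon, hcon'⟩ := hcon
  simp only [Finset.mem_union, not_or] at hv
  have hdis : ∀ x ∈ A, x ∉ B := fun x hx hx' => Finset.disjoint_left.1 hAB hx hx'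
  obtain ⟨z, hz, hvz⟩ : ∃ z ∈ A ∪ B, ¬ G.Adj v z := by
    by_contra! h
    refine hcon' ⟨{v}, A ∪ B, by simp, hA.mono Finset.subset_union_left, by simp [hv], rfl, ?_⟩
    intro x hx y hy hxy
    obtain rfl := Finset.mem_singleton.1 hx
    exact hxy.2 (h y hy)
  obtain ⟨z, hz, hvz, y, hy, hvy, hyz⟩ :
      ∃ z ∈ A ∪ B, ¬ G.Adj v z ∧ ∃ y ∈ A ∪ B, G.Adj v y ∧ G.Adj y z := by
    by_contra! h
    refine hcon ⟨(A ∪ B).filter (¬ G.Adj v ·), insert v ((A ∪ B).filter (G.Adj v ·)),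
      ⟨z, by simp_all⟩, by simp, ?_, ?_, ?_⟩
    · rw [Finset.disjoint_left]; grind
    · ext x; grind
    · intro x hx y hy
      simp only [Finset.mem_filter, Finset.mem_insert] at hx hy
      rcases hy with rfl | hy
      · exact fun h => hx.2 h.symm
      · exact fun h' => h x hx.1 hx.2 y hy.1 hy.2 h'.symm
  obtain ⟨a, ha, hva⟩ : ∃ a ∈ A, G.Adj v a := by
    by_contra! h
    refine hcon ⟨A, insert v B, hA, by simp, by simp [hv, hAB], by grind, ?_⟩
    grind [G.adj_comm]
  obtain ⟨b, hb, hvb⟩ : ∃ b ∈ B, G.Adj v b := by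
    by_contra! h
    refine hcon ⟨insert v A, B, by simp, hB, by simp [hv, hAB], by grind, ?_⟩
    grind [G.adj_comm]
  have key : ∀ w, w ≠ y → w ≠ z → w ≠ v → G.Adj v w → ¬ G.Adj w y → ¬ G.Adj w z → False := by
    intro w h1 h2 h3 h4 h5 h6
    refine hG ⟨w, v, y, z, ?_, h4.symm, hvy, hyz, h5, h6, hvz⟩
    have := hvy.ne
    have := hyz.ne
    have : v ≠ z := by rintro rfl; simp_all
    simp_all
  rcases Finset.mem_union.1 hy with hy | hy <;> rcases Finset.mem_union.1 hz with hz | hz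
  · exact key b (by grind) (by grind) (by grind) hvb (fun h => hadj _ hy _ hb h.symm)
      (fun h => hadj _ hz _ hb h.symm)
  · exact hadj _ hy _ hz hyz
  · exact hadj _ hz _ hy hyz.symm
  · exact key a (by grind) (by grind) (by grind) hva (hadj _ ha _ hy) (hadj _ ha _ hz)

theorem isDisjointUnionOn_or_compl {G : SimpleGraph V} (hG : IsCograph G) (S : Finset V)
    (hS : 2 ≤ S.card) : G.IsDisjointUnionOn S ∨ Gᶜ.IsDisjointUnionOn S := by
  induction S using Finset.induction_on with
  | empty => simp at hS
  | insert v S hv ih =>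
    rcases S.card.lt_or_ge 2 with h | h
    · rw [Finset.card_insert_of_notMem hv] at hS
      obtain ⟨w, rfl⟩ := Finset.card_eq_one.1 (show S.card = 1 by omega)
      by_cases hvw : G.Adj v w
      · exact .inr ⟨{v}, {w}, by simp, by simp, by simpa using hv, rfl, by simp [hvw]⟩
      · exact .inl ⟨{v}, {w}, by simp, by simp, by simpa using hv, rfl, by simp [hvw]⟩
    · rcases ih h with h | h
      · exact h.insert_vertex hG hv
      · simpa [or_comm] using h.insert_vertex (isCograph_compl hG) hv

/-- The vertices of a path do not split into two nonempty sets without edges in between. -/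
theorem not_isDisjointUnionOn_of_isChain {G : SimpleGraph V} {l : List V}
    (hl : l.IsChain G.Adj) : ¬ G.IsDisjointUnionOn l.toFinset := by
  rintro ⟨A, B, ⟨a, ha⟩, ⟨b, hb⟩, hAB, hun, hadj⟩
  have hdis : ∀ x ∈ A, x ∉ B := fun x hx hx' => Finset.disjoint_left.1 hAB hx hx'
  have hmem : ∀ x, x ∈ l ↔ x ∈ A ∨ x ∈ B := fun x => by
    rw [← List.mem_toFinset, ← hun, Finset.mem_union]
  have key : ∀ m : List V, m.IsChain G.Adj → (∀ x ∈ m, x ∈ A ∨ x ∈ B) →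
      (∀ x ∈ m, x ∈ A) ∨ (∀ x ∈ m, x ∈ B) := by
    intro m hm hmAB
    induction m with
    | nil => simp
    | cons x m ih =>
      cases m with
      | nil => simpa using hmAB
      | cons y m =>
        rw [List.isChain_cons_cons] at hm
        have := ih hm.2 (fun z hz => hmAB z (List.mem_cons_of_mem _ hz))
        have := hadj x
        have := hadj y
        grind [G.adj_comm]
  rcases key l hl fun x hx => (hmem x).1 hx with h | h
  · exact hdis b (h b ((hmem b).2 (.inr hb))) hb
  · exact hdis a ha (h a ((hmem a).2 (.inl ha)))

section Counting

variable (G : SimpleGraph V) [DecidableRel G.Adj]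

theorem card_interedges_add_le {S T : Finset V} (h : Disjoint S T) :
    (G.interedges S S).card + (G.interedges T T).card ≤ (G.interedges (S ∪ T) (S ∪ T)).card := by
  rw [← Finset.card_union_of_disjoint]
  · apply Finset.card_le_card
    rintro ⟨x, y⟩
    simp only [Finset.mem_union, mem_interedges_iff]
    tauto
  · rw [Finset.disjoint_left] at h ⊢
    rintro ⟨x, y⟩
    simp only [mem_interedges_iff]
    exact fun hx hy => h hx.1 hy.1

theorem two_mul_card_mul_card_add_le {A B : Finset V} (h : Disjoint A B)
    (hadj : ∀ x ∈ A, ∀ y ∈ B, G.Adj x y) :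
    2 * (A.card * B.card) + (G.interedges B B).card ≤ (G.interedges (A ∪ B) (A ∪ B)).card := by
  rw [Finset.disjoint_left] at h
  have h1 : Disjoint (A ×ˢ B) (B ×ˢ A) := by
    rw [Finset.disjoint_left]
    rintro ⟨x, y⟩
    simp only [Finset.mem_product]
    exact fun hx hy => h hx.1 hy.1
  have h2 : Disjoint (A ×ˢ B ∪ B ×ˢ A) (G.interedges B B) := by
    rw [Finset.disjoint_left]
    rintro ⟨x, y⟩
    simp only [Finset.mem_union, Finset.mem_product, mem_interedges_iff]
    rintro (hx | hx) hy
    · exact h hx.1 hy.1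
    · exact h hx.2 hy.2.1
  calc 2 * (A.card * B.card) + (G.interedges B B).card
      = (A ×ˢ B ∪ B ×ˢ A ∪ G.interedges B B).card := by
        rw [Finset.card_union_of_disjoint h2, Finset.card_union_of_disjoint h1,
          Finset.card_product, Finset.card_product]
        ring
    _ ≤ _ := by
        apply Finset.card_le_card
        rintro ⟨x, y⟩
        simp only [Finset.mem_union, Finset.mem_product, mem_interedges_iff]
        rintro ((⟨hx, hy⟩ | ⟨hx, hy⟩) | hx)
        · exact ⟨.inl hx, .inr hy, hadj _ hx _ hy⟩
        · exact ⟨.inr hx, .inl hy, (hadj _ hy _ hx).symm⟩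
        · tauto

theorem sum_card_interedges_le_flatten (L : List (List V)) (hL : L.flatten.Nodup) :
    (L.map fun p => (G.interedges p.toFinset p.toFinset).card).sum ≤
      (G.interedges L.flatten.toFinset L.flatten.toFinset).card := by
  induction L with
  | nil => simp
  | cons p L ih =>
    rw [List.flatten_cons, List.nodup_append'] at hL
    have := G.card_interedges_add_le (List.disjoint_toFinset_iff_disjoint.2 hL.2.2)
    simp only [List.map_cons, List.sum_cons, List.flatten_cons, List.toFinset_append]
    have := ih hL.2.1
    omega

end Counting

end SimpleGraph

/-- Deleting `k` entries from a list leaves `k + 1` (possibly empty) contiguous pieces. -/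
theorem List.exists_infix_flatten_eq_filter {α : Type*} (P : α → Bool) (l : List α) :
    ∃ L : List (List α), L.length = (l.filter fun x => !P x).length + 1 ∧
      L.flatten = l.filter P ∧ ∀ p ∈ L, p <:+: l := by
  suffices h : ∃ (h : List α) (t : List (List α)), h <+: l ∧
      t.length = (l.filter fun x => !P x).length ∧
      (h :: t).flatten = l.filter P ∧ ∀ p ∈ t, p <:+: l by
    obtain ⟨h, t, hl, ht, hf, hi⟩ := h
    exact ⟨h :: t, by simp [ht], hf, by simpa using ⟨hl.isInfix, hi⟩⟩
  induction l with
  | nil => exact ⟨[], [], by simp⟩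
  | cons x l ih =>
    obtain ⟨h, t, hl, ht, hf, hi⟩ := ih
    have hi' : ∀ p ∈ t, p <:+: x :: l := fun p hp => (hi p hp).trans (List.suffix_cons x l).isInfix
    cases hx : P x with
    | false =>
      refine ⟨[], h :: t, List.nil_prefix, by simp [hx, ht], by simpa [hx] using hf, ?_⟩
      simpa using ⟨hl.isInfix.trans (List.suffix_cons x l).isInfix, hi'⟩
    | true =>
      exact ⟨x :: h, t, by simpa using hl, by simp [hx, ht], by simpa [hx] using hf, hi'⟩

/-- Tangent line bound for `x log x` at `c`. -/
theorem Nat.mul_log_add_sub_le_mul_log (p : ℕ) {c : ℝ} (hc : 0 < c) :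
    p * Real.log c + p - c ≤ p * Real.log p := by
  rcases p.eq_zero_or_pos with rfl | hp
  · simpa using hc.le
  · have hp' : (0 : ℝ) < p := by exact_mod_cast hp
    have h := Real.log_le_sub_one_of_pos (_root_.div_pos hc hp')
    rw [Real.log_div hc.ne' hp'.ne'] at h
    have := mul_le_mul_of_nonneg_left h hp'.le
    have h3 : (p : ℝ) * (c / p - 1) = c - p := by field_simp
    linarith

theorem List.sum_length_mul_log_ge {α : Type*} (L : List (List α)) {c : ℝ} (hc : 0 < c) :
    L.flatten.length * Real.log c + L.flatten.length - L.length * c ≤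
      (L.map fun p => (p.length : ℝ) * Real.log p.length).sum := by
  induction L with
  | nil => simp
  | cons p L ih =>
    have := Nat.mul_log_add_sub_le_mul_log p.length hc
    simp only [List.flatten_cons, List.length_append, List.length_cons, List.map_cons,
      List.sum_cons, Nat.cast_add, Nat.cast_one]
    linarith

theorem Real.add_mul_log_add_le {a b : ℕ} (ha : 1 ≤ a) (hab : a ≤ b) :
    ((a + b : ℕ) : ℝ) * Real.log (a + b : ℕ) ≤
      4 * Real.log 2 * (a * b) + b * Real.log (b / (a + 1)) := by
  have ha' : (1 : ℝ) ≤ a := by exact_mod_cast ha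
  have hab' : (a : ℝ) ≤ b := by exact_mod_cast hab
  have hb' : (0 : ℝ) < b := by linarith
  have hlog2 : 0 < Real.log 2 := Real.log_pos (by norm_num)
  have h1 : Real.log (a + 1) ≤ a * Real.log 2 := by
    rw [← Real.log_pow]
    exact Real.log_le_log (by positivity) (by exact_mod_cast Nat.lt_two_pow_self (n := a))
  have h2 : Real.log b + Real.log 2 ≤ b * Real.log 2 := by
    rw [← Real.log_pow, ← Real.log_mul hb'.ne' (by norm_num)]
    obtain ⟨k, rfl⟩ : ∃ k, b = k + 1 := ⟨b - 1, by omega⟩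
    refine Real.log_le_log (by positivity) ?_
    have : k + 1 ≤ 2 ^ k := Nat.lt_two_pow_self
    rw [pow_succ]
    gcongr
    exact_mod_cast this
  have h3 : Real.log (a + b) ≤ Real.log b + Real.log 2 := by
    rw [← Real.log_mul hb'.ne' (by norm_num)]
    exact Real.log_le_log (by positivity) (by linarith)
  rw [Real.log_div hb'.ne' (by positivity)]
  push_cast
  have h4 := mul_le_mul_of_nonneg_left h1 hb'.le
  have h5 := mul_le_mul_of_nonneg_left h2 (show (0 : ℝ) ≤ a by linarith)
  have h6 := mul_le_mul_of_nonneg_left h3 (show (0 : ℝ) ≤ a + b by linarith)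
  have h7 : b * Real.log 2 ≤ a * (b * Real.log 2) :=
    le_mul_of_one_le_left (by positivity) ha'
  have h8 : 0 ≤ a * (b * Real.log 2) := by positivity
  linarith

namespace SimpleGraph

theorem length_mul_log_length_le {V : Type*} [DecidableEq V] (G : SimpleGraph V)
    [DecidableRel G.Adj] (hG : IsCograph G) (l : List V) (hn : l.Nodup) (hc : l.IsChain G.Adj) :
    (l.length : ℝ) * Real.log l.length ≤
      2 * Real.log 2 * (G.interedges l.toFinset l.toFinset).card := by
  induction hk : l.length using Nat.strong_induction_on generalizing l with
  | _ k ih =>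
  subst hk
  have hlog2 : 0 < Real.log 2 := Real.log_pos (by norm_num)
  rcases Nat.lt_or_ge l.length 2 with hlen | hlen
  · have : (l.length : ℝ) * Real.log l.length = 0 := by
      interval_cases l.length <;> simp
    rw [this]
    positivity
  have hcard : l.toFinset.card = l.length := List.toFinset_card_of_nodup hn
  obtain ⟨A, B, hA, hB, hAB, hun, hadj⟩ :=
    (isDisjointUnionOn_or_compl hG l.toFinset (hcard ▸ hlen)).resolve_left
      (not_isDisjointUnionOn_of_isChain hc)
  wlog hle : A.card ≤ B.card generalizing A B
  · exact this B A hB hA hAB.symm (by rw [Finset.union_comm, hun])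
      (fun x hx y hy h => hadj y hy x hx h.symm) (by omega)
  have hdis := Finset.disjoint_left.1 hAB
  have hmem : ∀ x, x ∈ l ↔ x ∈ A ∨ x ∈ B := fun x => by
    rw [← List.mem_toFinset, ← hun, Finset.mem_union]
  have hjoin : ∀ x ∈ A, ∀ y ∈ B, G.Adj x y := by
    intro x hx y hy
    by_contra h
    exact hadj x hx y hy ⟨fun e => hdis hx (e ▸ hy), h⟩
  obtain ⟨L, hLlen, hLflat, hLinf⟩ := l.exists_infix_flatten_eq_filter (fun x => decide (x ∈ B))
  have hLn : L.flatten.Nodup := hLflat ▸ hn.filter _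
  have hBL : L.flatten.toFinset = B := by
    ext x
    simp only [hLflat, List.mem_toFinset, List.mem_filter, decide_eq_true_eq, hmem]
    tauto
  have hBlen : L.flatten.length = B.card := by
    rw [← hBL, List.toFinset_card_of_nodup hLn]
  have hAlen : (l.filter fun x => !decide (x ∈ B)).length = A.card := by
    rw [← List.toFinset_card_of_nodup (hn.filter _)]
    congr 1
    ext x
    have := @hdis x
    simp only [List.mem_toFinset, List.mem_filter, Bool.not_eq_true', decide_eq_false_iff_not, hmem]
    tauto
  rw [hAlen] at hLlen
  have hlenAB : l.length = A.card + B.card := by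
    rw [← hcard, ← hun, Finset.card_union_of_disjoint hAB]
  have hApos := hA.card_pos
  have hBpos : (0 : ℝ) < B.card := by exact_mod_cast hB.card_pos
  have hpieces : (L.map fun p => (p.length : ℝ) * Real.log p.length).sum ≤
      2 * Real.log 2 * (G.interedges B B).card := by
    calc _ ≤ (L.map fun p =>
          2 * Real.log 2 * ((G.interedges p.toFinset p.toFinset).card : ℝ)).sum := by
          refine List.sum_le_sum fun p hp => ih _ ?_ p (hn.sublist (hLinf p hp).sublist)
            (hc.infix (hLinf p hp)) rfl
          have := (List.sublist_flatten_of_mem hp).length_le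
          omega
      _ = 2 * Real.log 2 *
          ((L.map fun p => (G.interedges p.toFinset p.toFinset).card).sum : ℕ) := by
          rw [List.sum_map_mul_left, Nat.cast_list_sum, List.map_map]
          rfl
      _ ≤ _ := by
          rw [← hBL]
          gcongr
          exact G.sum_card_interedges_le_flatten L hLn
  have hconv := L.sum_length_mul_log_ge (c := (B.card : ℝ) / (A.card + 1))
    (div_pos hBpos (Nat.cast_add_one_pos _))
  rw [hBlen, hLlen] at hconv
  have hcancel : ((A.card + 1 : ℕ) : ℝ) * ((B.card : ℝ) / (A.card + 1)) = B.card := by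
    rw [Nat.cast_add_one, mul_div_cancel₀ _ (Nat.cast_add_one_ne_zero _)]
  have hedges : 2 * ((A.card : ℝ) * B.card) + (G.interedges B B).card ≤
      (G.interedges l.toFinset l.toFinset).card := by
    rw [← hun]
    exact_mod_cast G.two_mul_card_mul_card_add_le hAB hjoin
  have hmain := Real.add_mul_log_add_le hApos hle
  rw [hlenAB]
  have := mul_le_mul_of_nonneg_left hedges (show 0 ≤ 2 * Real.log 2 by positivity)
  linarith

end SimpleGraph

/-- A traceable cograph on `n` vertices contains at least `(1/4)·n·log₂ n` edges. -/
theorem stmt_4 {V : Type*} [Fintype V] [DecidableEq V] (G : SimpleGraph V)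
    (hcog : IsCograph G) (hG : Traceable G) :
    (1 / 4 : ℝ) * (Fintype.card V : ℝ) * Real.logb 2 (Fintype.card V) ≤
      (G.edgeSet.ncard : ℝ) := by
  classical
  obtain ⟨u, v, p, hp⟩ := hG
  have huniv : p.support.toFinset = Finset.univ := by
    ext x
    simpa using hp.mem_support x
  have hlen : p.support.length = Fintype.card V := by
    rw [← List.toFinset_card_of_nodup hp.isPath.support_nodup, huniv, Finset.card_univ]
  have h := G.length_mul_log_length_le hcog p.support hp.isPath.support_nodup p.isChain_adj_support
  have hedge : (G.interedges Finset.univ Finset.univ).card = 2 * G.edgeSet.ncard := by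
    rw [Set.ncard_eq_toFinset_card', ← SimpleGraph.edgeFinset, ← G.sum_degrees_eq_twice_card_edges]
    simp only [SimpleGraph.interedges, Rel.interedges, Finset.univ_product_univ,
      Finset.card_filter, Fintype.sum_prod_type, ← SimpleGraph.card_neighborFinset_eq_degree,
      SimpleGraph.neighborFinset_eq_filter]
  rw [huniv, hlen, hedge] at h
  have hlog2 : 0 < Real.log 2 := Real.log_pos (by norm_num)
  rw [Real.logb, ← mul_div_assoc, div_le_iff₀ hlog2]
  push_cast at h
  linarith
end

section
/- Let G be a traceable simple graph on n vertices with n ≥ 4·max{cvd(G), 1}, where cvd(G) denotes the cluster vertex deletion number of G. Then G contains at least (1/16)·n²/(cvd(G)+1) edges. -/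
/-- A cluster graph is a graph in which every connected component is a clique. -/
def IsClusterGraph {V : Type*} (G : SimpleGraph V) : Prop :=
  ∀ c : G.ConnectedComponent, G.IsClique {v | G.connectedComponentMk v = c}

/-- The cluster vertex deletion number of `G`: the minimum size of a vertex set whose
deletion yields a cluster graph. -/
noncomputable def cvd {V : Type*} [Fintype V] [DecidableEq V] (G : SimpleGraph V) : ℕ :=
  sInf {k | ∃ S : Finset V, S.card ≤ k ∧ IsClusterGraph (G.induce (↑(Sᶜ) : Set V))}

/-- Walking along `p`, the value of `f` only changes by passing through `S`, so `f` takes few values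
outside `S`. -/
lemma SimpleGraph.Walk.card_image_support_le {V α : Type*} [DecidableEq V] [DecidableEq α]
    {G : SimpleGraph V} (S : Finset V) (f : V → α)
    (hf : ∀ u v, u ∉ S → v ∉ S → G.Adj u v → f u = f v) {u v : V} (p : G.Walk u v) :
    ((p.support.toFinset \ S).image f).card ≤
      (p.support.filter (· ∈ S)).length + if u ∈ S then 0 else 1 := by
  induction p with
  | @nil u =>
    have h : (({u} \ S).image f).card ≤ 1 :=
      Finset.card_image_le.trans (Finset.card_le_card Finset.sdiff_subset)
    by_cases hu : u ∈ S <;> simpa [hu] using h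
  | @cons u v w h p ih =>
    rw [SimpleGraph.Walk.support_cons, List.toFinset_cons]
    by_cases hu : u ∈ S
    · rw [Finset.insert_sdiff_of_mem _ hu]
      simp only [hu, List.filter_cons, decide_true, if_true, List.length_cons]
      split_ifs at ih <;> omega
    · rw [Finset.insert_sdiff_of_notMem _ hu, Finset.image_insert]
      simp only [hu, List.filter_cons, decide_false, if_false]
      by_cases hv : v ∈ S
      · simp only [hv, if_true] at ih
        exact (Finset.card_insert_le _ _).trans (by simpa using ih)
      · simp only [hv, if_false] at ih
        rw [Finset.insert_eq_of_mem]
        · simpa using ih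
        · exact Finset.mem_image.2 ⟨v, by simp [hv], (hf u v hu hv h).symm⟩

/-- If distinct vertices of `T` with the same value of `f` are adjacent, then `G` has
many edges unless `f` takes many values on `T`. -/
lemma SimpleGraph.sq_card_le_of_adj_of_eq {V α : Type*} [Fintype V] [DecidableEq V]
    [DecidableEq α] (G : SimpleGraph V) [DecidableRel G.Adj] (T : Finset V) (f : V → α)
    (hf : ∀ u ∈ T, ∀ v ∈ T, u ≠ v → f u = f v → G.Adj u v) :
    T.card ^ 2 ≤ (T.image f).card * (2 * G.edgeFinset.card + T.card) := by
  have hT : T.card = ∑ b ∈ T.image f, (T.filter (f · = b)).card :=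
    Finset.card_eq_sum_card_image f T
  have hsq : ∑ b ∈ T.image f, (T.filter (f · = b)).card ^ 2
      = ∑ u ∈ T, (T.filter (f · = f u)).card := by
    rw [Finset.sum_comp (fun b => (T.filter (f · = b)).card) f]
    simp [sq]
  have hdeg : ∑ u ∈ T, (T.filter (f · = f u)).card ≤ 2 * G.edgeFinset.card + T.card := by
    calc ∑ u ∈ T, (T.filter (f · = f u)).card
        ≤ ∑ u ∈ T, (G.degree u + 1) := by
          refine Finset.sum_le_sum fun u hu => ?_
          rw [← Finset.card_erase_add_one (a := u) (by simp [hu])]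
          refine Nat.add_le_add_right (Finset.card_le_card fun v hv => ?_) 1
          simp only [Finset.mem_erase, Finset.mem_filter] at hv
          exact (G.mem_neighborFinset u v).2 (hf u hu v hv.2.1 hv.1.symm hv.2.2.symm)
      _ = ∑ u ∈ T, G.degree u + T.card := by simp [Finset.sum_add_distrib]
      _ ≤ 2 * G.edgeFinset.card + T.card := by
          rw [← G.sum_degrees_eq_twice_card_edges]
          exact Nat.add_le_add_right
            (Finset.sum_le_sum_of_subset (Finset.subset_univ T)) _
  calc T.card ^ 2 = (∑ b ∈ T.image f, (T.filter (f · = b)).card) ^ 2 := by rw [← hT]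
    _ ≤ (T.image f).card * ∑ b ∈ T.image f, (T.filter (f · = b)).card ^ 2 :=
        sq_sum_le_card_mul_sum_sq
    _ ≤ _ := Nat.mul_le_mul_left _ (hsq.trans_le hdeg)

/-- The infimum defining `cvd` is attained. -/
lemma exists_card_le_cvd {V : Type*} [Fintype V] [DecidableEq V] (G : SimpleGraph V) :
    ∃ S : Finset V, S.card ≤ cvd G ∧ IsClusterGraph (G.induce (↑(Sᶜ) : Set V)) := by
  refine Nat.sInf_mem (s := {k | ∃ S : Finset V, S.card ≤ k ∧
    IsClusterGraph (G.induce (↑(Sᶜ) : Set V))})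
    ⟨Fintype.card V, Finset.univ, le_rfl, fun c x _ => ?_⟩
  exact absurd x.2 (by simp)

/-- If deleting `S` from `G` yields a cluster graph, then some labelling of the vertices outside `S`
identifies exactly the adjacent ones. -/
lemma IsClusterGraph.exists_labelling {V : Type*} [Fintype V] [DecidableEq V]
    {G : SimpleGraph V} {S : Finset V} (h : IsClusterGraph (G.induce (↑(Sᶜ) : Set V))) :
    ∃ f : V → Option (G.induce (↑(Sᶜ) : Set V)).ConnectedComponent,
      ∀ u v, u ∉ S → v ∉ S → u ≠ v → (G.Adj u v ↔ f u = f v) := by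
  refine ⟨fun v => if hv : v ∈ (↑(Sᶜ) : Set V) then
    some ((G.induce (↑(Sᶜ) : Set V)).connectedComponentMk ⟨v, hv⟩) else none,
    fun u v hu hv huv => ?_⟩
  have hu' : u ∈ (↑(Sᶜ) : Set V) := by simpa using hu
  have hv' : v ∈ (↑(Sᶜ) : Set V) := by simpa using hv
  simp only [dif_pos hu', dif_pos hv', Option.some_inj]
  refine ⟨fun hadj => ?_, fun heq => ?_⟩
  · exact SimpleGraph.ConnectedComponent.connectedComponentMk_eq_of_adj
      (SimpleGraph.comap_adj.2 hadj)
  · exact SimpleGraph.comap_adj.1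
      (h _ (Set.mem_ofPred.2 heq) (Set.mem_ofPred.2 rfl) (by simpa using huv))

/-- A traceable graph on `n ≥ 4·max{cvd(G),1}` vertices has at least
`(1/16)·n²/(cvd(G)+1)` edges. -/
theorem stmt_12 {V : Type*} [Fintype V] [DecidableEq V] (G : SimpleGraph V)
    (hG : Traceable G) (hn : 4 * max (cvd G) 1 ≤ Fintype.card V) :
    (1 / 16 : ℝ) * (Fintype.card V : ℝ) ^ 2 / (cvd G + 1) ≤ (G.edgeSet.ncard : ℝ) := by
  classical
  obtain ⟨S, hS, hcl⟩ := exists_card_le_cvd G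
  obtain ⟨f, hf⟩ := hcl.exists_labelling
  obtain ⟨u, v, p, hp⟩ := hG
  have himg : ((Sᶜ).image f).card ≤ cvd G + 1 := by
    have h := p.card_image_support_le S f fun a b ha hb hab => (hf a b ha hb hab.ne).1 hab
    have hsupp : p.support.toFinset = Finset.univ :=
      Finset.eq_univ_of_forall fun a => List.mem_toFinset.2 (hp.mem_support a)
    have hlen : (p.support.filter (· ∈ S)).length = S.card := by
      rw [← List.toFinset_card_of_nodup (hp.isPath.support_nodup.filter _), List.toFinset_filter,
        hsupp]
      simp
    rw [hsupp, hlen, ← Finset.compl_eq_univ_sdiff] at h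
    split_ifs at h <;> omega
  have hcount := G.sq_card_le_of_adj_of_eq Sᶜ f fun a ha b hb hab =>
    (hf a b (Finset.mem_compl.1 ha) (Finset.mem_compl.1 hb) hab).2
  have hmul := hcount.trans (Nat.mul_le_mul_right _ himg)
  have hE : G.edgeSet.ncard = G.edgeFinset.card := by
    rw [← SimpleGraph.coe_edgeFinset, Set.ncard_coe_finset]
  have hcard : (Sᶜ).card + S.card = Fintype.card V := Finset.card_compl_add_card S
  have hn4 : 4 ≤ Fintype.card V := by omega
  have hnk : 4 * cvd G ≤ Fintype.card V := by omega
  have hm : Fintype.card V ≤ (Sᶜ).card + cvd G := by omega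
  rw [hE, div_le_iff₀ (by positivity)]
  generalize (Sᶜ).card = m at *
  generalize cvd G = k at *
  generalize Fintype.card V = n at *
  generalize G.edgeFinset.card = e at *
  rify at *
  have hk : (0 : ℝ) ≤ k := k.cast_nonneg
  have hprod : (3 / 4 * n : ℝ) * (n / 2 - 1) ≤ m * (m - k - 1) :=
    mul_le_mul (by linarith) (by linarith) (by linarith) (by linarith)
  nlinarith
end
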